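/- There is no simple graph G on exactly 10 vertices with two longest paths P and Q satisfying all of the following: V(G) = V(P) ∪ V(Q); |V(P) ∩ V(Q)| = 6; V(P) \ V(Q) = {a, b} where a and b are not consecutive on P; V(Q) \ V(P) = {c, d} where c and d are not consecutive on Q; the subgraph of G induced on {a, b, c, d} is connected; and no endpoint of P lies in {a, b} and no endpoint of Q lies in {c, d}. -/

import Mathlib

open SimpleGraph

/-- `P` is a longest path in the simple graph `G`: it is a path, and every path in `G`
has length at most the length of `P`. -/
def IsLongestPath {V : Type*} (G : SimpleGraph V) {u v : V} (P : G.Walk u v) : Prop :=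
  P.IsPath ∧ ∀ {a b : V} (Q : G.Walk a b), Q.IsPath → Q.length ≤ P.length

/-- The vertex sequences of nine-vertex paths on the labels `0, …, 9` among which a detour longer
than the path `0, 1, …, 7` is looked for. -/
def detours : List (List ℕ) := [
  [0, 1, 2, 3, 4, 5, 6, 7, 9],
  [7, 6, 5, 4, 3, 2, 1, 0, 9],
  [0, 7, 6, 5, 4, 3, 2, 1, 8],
  [0, 1, 2, 3, 4, 5, 7, 6, 8],
  [0, 1, 2, 3, 4, 8, 6, 5, 9],
  [7, 6, 5, 4, 3, 8, 1, 2, 9],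
  [0, 1, 2, 3, 4, 5, 6, 7, 8],
  [0, 1, 2, 7, 6, 5, 4, 3, 8],
  [0, 2, 1, 8, 3, 4, 5, 6, 7],
  [0, 5, 4, 3, 2, 1, 8, 6, 7],
  [2, 3, 8, 1, 0, 4, 5, 6, 7],
  [0, 1, 2, 3, 7, 6, 5, 4, 8],
  [1, 0, 7, 6, 5, 4, 3, 2, 8],
  [7, 6, 5, 8, 1, 2, 3, 4, 9],
  [0, 1, 2, 8, 6, 5, 4, 3, 9],
  [0, 1, 2, 3, 5, 4, 8, 6, 7],
  [0, 1, 8, 3, 2, 4, 5, 6, 7],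
  [0, 1, 8, 6, 5, 4, 3, 2, 9],
  [0, 1, 2, 3, 8, 6, 5, 4, 9],
  [7, 6, 8, 1, 2, 3, 4, 5, 9],
  [7, 6, 5, 4, 8, 1, 2, 3, 9],
  [0, 1, 2, 3, 4, 7, 6, 5, 8],
  [1, 0, 3, 2, 8, 4, 5, 6, 7],
  [1, 0, 5, 4, 3, 2, 8, 6, 7],
  [2, 3, 4, 5, 8, 1, 0, 6, 7],
  [0, 1, 2, 3, 8, 6, 5, 4, 7],
  [0, 1, 8, 4, 3, 2, 7, 6, 5],
  [0, 3, 2, 1, 8, 4, 5, 6, 7],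
  [3, 2, 0, 1, 8, 4, 5, 6, 7],
  [0, 1, 7, 6, 5, 4, 3, 2, 8],
  [0, 1, 2, 8, 3, 4, 5, 6, 7],
  [0, 1, 2, 3, 4, 8, 5, 6, 7],
  [0, 8, 1, 2, 3, 4, 5, 6, 7],
  [0, 1, 2, 3, 4, 5, 6, 8, 9],
  [0, 1, 2, 5, 4, 3, 8, 6, 7],
  [0, 1, 8, 4, 3, 2, 5, 6, 7],
  [0, 1, 8, 2, 3, 4, 5, 6, 7],
  [0, 1, 2, 3, 4, 5, 8, 6, 7],
  [0, 1, 2, 3, 8, 4, 5, 6, 7],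
  [0, 1, 2, 3, 4, 5, 6, 9, 8],
  [0, 1, 2, 3, 8, 5, 4, 6, 7],
  [0, 1, 8, 5, 4, 3, 2, 6, 7],
  [0, 1, 2, 3, 4, 9, 8, 5, 6],
  [0, 1, 3, 2, 8, 4, 5, 6, 7],
  [0, 1, 5, 4, 3, 2, 8, 6, 7],
  [0, 1, 9, 8, 2, 3, 4, 5, 6],
  [1, 0, 8, 2, 3, 4, 5, 6, 7],
  [7, 6, 5, 4, 3, 2, 1, 8, 9],
  [2, 1, 0, 8, 3, 4, 5, 6, 7],
  [0, 1, 2, 3, 9, 8, 4, 5, 6],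
  [0, 1, 2, 3, 9, 8, 5, 6, 7],
  [0, 1, 2, 3, 4, 8, 9, 5, 6],
  [0, 1, 2, 9, 8, 3, 4, 5, 6],
  [3, 2, 1, 0, 8, 4, 5, 6, 7],
  [0, 1, 9, 4, 3, 2, 8, 6, 5],
  [0, 1, 9, 8, 3, 4, 5, 6, 7],
  [4, 3, 2, 1, 0, 8, 5, 6, 7]]

/-- The two bits of the adjacency bitmask that encode an edge between the labels `x` and `y`. -/
def edgeMask (x y : ℕ) : ℕ := 1 <<< (10 * x + y) ||| 1 <<< (10 * y + x)

/-- The adjacency bitmask of the path through a list of labels. -/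
def pathMask : List ℕ → ℕ
  | x :: y :: l => edgeMask x y ||| pathMask (y :: l)
  | _ => 0

/-- Some bitmask in `Ms` is contained in `E`. -/
def containsMask (Ms : List ℕ) (E : ℕ) : Bool := Ms.any fun M => (E &&& M).beq M

/-- Application of `f` to `n`, defined by recursion so that kernel reduction first evaluates `n`
to a literal. -/
def applyEvaluated (n : ℕ) (f : ℕ → Bool) : Bool :=
  Nat.rec (f 0) (fun m _ => f m.succ) n

theorem applyEvaluated_eq (n : ℕ) (f : ℕ → Bool) : applyEvaluated n f = f n := by
  cases n <;> rfl

/-- Every way of prolonging a path at its end `y` through all the labels in `U`, with last label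
below `8`, produces a graph containing one of the masks `Ms`. -/
def extendOne (Ms : List ℕ) : ℕ → ℕ → ℕ → List ℕ → Bool
  | 0, _, _, _ => false
  | n + 1, E, y, U => containsMask Ms E ||
      ((!U.isEmpty || Nat.ble 8 y) && U.all fun v =>
        applyEvaluated (E ||| edgeMask y v) fun F => extendOne Ms n F v (U.erase v))

/-- Every way of prolonging a path at its two ends `x` and `y` through all the labels in `U`, with
both final ends below `8`, produces a graph containing one of the masks `Ms`. -/
def extendBoth (Ms : List ℕ) : ℕ → ℕ → ℕ → ℕ → List ℕ → Bool
  | 0, _, _, _, _ => false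
  | n + 1, E, x, y, U => containsMask Ms E ||
      ((U.all fun v =>
        applyEvaluated (E ||| edgeMask x v) fun F => extendBoth Ms n F y v (U.erase v)) &&
        (Nat.ble 8 x || extendOne Ms n E y U))

/-- The labels other than `8`, `i` and `j` that the second path has to visit. -/
def otherLabels (i j : ℕ) : List ℕ := 9 :: ((List.range 8).erase i).erase j

/-- The adjacency bitmask of the path `0, 1, …, 7` together with an edge from `i` to `8`. -/
def startMask (i : ℕ) : ℕ := pathMask (List.range 8) ||| edgeMask i 8

/-- The finite search over all positions `i` and `j` that are interior and not consecutive. -/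
def searchAll (Ms : List ℕ) : Bool :=
  [1, 2, 3, 4, 5, 6].all fun i => [1, 2, 3, 4, 5, 6].all fun j =>
    i.beq j || i.succ.beq j || i.beq j.succ ||
      extendBoth Ms 10 (startMask i) 8 8 (otherLabels i j)

theorem searchAll_detours : searchAll (detours.map pathMask) = true := by decide +kernel

theorem detours_valid :
    ∀ l ∈ detours, l.Nodup ∧ l.length = 9 ∧ ∀ x ∈ l, x < 10 := by decide +kernel

/-- Every bit of `E` encodes a pair of related labels. -/
def Encodes (R : ℕ → ℕ → Prop) (E : ℕ) : Prop :=
  ∀ x y, y < 10 → E.testBit (10 * x + y) = true → R x y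

/-- There are nine distinct labels forming a path in `R`. -/
def HasNinePath (R : ℕ → ℕ → Prop) : Prop :=
  ∃ l : List ℕ, l.Nodup ∧ l.length = 9 ∧ l.IsChain R

section Search

variable {R : ℕ → ℕ → Prop}

theorem testBit_edgeMask_self (x y : ℕ) : (edgeMask x y).testBit (10 * x + y) = true := by
  simp [edgeMask, Nat.testBit_or, Nat.one_shiftLeft, Nat.testBit_two_pow]

theorem Encodes.lor {E F : ℕ} (hE : Encodes R E) (hF : Encodes R F) : Encodes R (E ||| F) := by
  intro x y hy h
  rw [Nat.testBit_or, Bool.or_eq_true] at h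
  exact h.elim (hE x y hy) (hF x y hy)

theorem Encodes.of_land_eq {E M : ℕ} (hE : Encodes R E) (h : E &&& M = M) : Encodes R M := by
  intro x y hy hM
  rw [← h, Nat.testBit_and, Bool.and_eq_true] at hM
  exact hE x y hy hM.1

theorem encodes_edgeMask (hsymm : ∀ x y, R x y → R y x) (hlt : ∀ x y, R x y → x < 10) {x y : ℕ}
    (h : R x y) : Encodes R (edgeMask x y) := by
  intro u v hv huv
  have hx := hlt _ _ h
  have hy := hlt _ _ (hsymm _ _ h)
  simp only [edgeMask, Nat.testBit_or, Nat.one_shiftLeft, Nat.testBit_two_pow, Bool.or_eq_true,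
    decide_eq_true_eq] at huv
  rcases huv with huv | huv
  · obtain ⟨rfl, rfl⟩ : x = u ∧ y = v := by omega
    exact h
  · obtain ⟨rfl, rfl⟩ : x = v ∧ y = u := by omega
    exact hsymm _ _ h

theorem encodes_pathMask (hsymm : ∀ x y, R x y → R y x) (hlt : ∀ x y, R x y → x < 10) :
    ∀ {l : List ℕ}, l.IsChain R → Encodes R (pathMask l)
  | [], _ => by simp [Encodes, pathMask]
  | [_], _ => by simp [Encodes, pathMask]
  | _ :: _ :: _, h =>
    (encodes_edgeMask hsymm hlt h.rel).lor (encodes_pathMask hsymm hlt h.of_cons)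

theorem isChain_of_encodes_pathMask :
    ∀ {l : List ℕ}, (∀ x ∈ l, x < 10) → Encodes R (pathMask l) → l.IsChain R
  | [], _, _ => .nil
  | [_], _, _ => .singleton _
  | x :: y :: l, hl, h => by
    refine List.isChain_cons_cons.2 ⟨h x y (hl y (by simp)) ?_, ?_⟩
    · simp [pathMask, Nat.testBit_or, testBit_edgeMask_self]
    · refine isChain_of_encodes_pathMask (fun z hz => hl z (List.mem_cons_of_mem _ hz)) ?_
      intro u v hv huv
      exact h u v hv (by simp [pathMask, Nat.testBit_or, huv])

theorem hasNinePath_of_containsMask {E : ℕ} (hE : Encodes R E)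
    (h : containsMask (detours.map pathMask) E = true) : HasNinePath R := by
  obtain ⟨M, hM, hEM⟩ := List.any_eq_true.1 h
  obtain ⟨l, hl, rfl⟩ := List.mem_map.1 hM
  obtain ⟨hnodup, hlen, hlt⟩ := detours_valid l hl
  exact ⟨l, hnodup, hlen,
    isChain_of_encodes_pathMask hlt (hE.of_land_eq (Nat.eq_of_beq_eq_true hEM))⟩

theorem hasNinePath_of_extendOne (hsymm : ∀ x y, R x y → R y x) (hlt : ∀ x y, R x y → x < 10)
    (n : ℕ) : ∀ {E y : ℕ} {U r : List ℕ}, extendOne (detours.map pathMask) n E y U = true →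
      Encodes R E → r.Perm U → (y :: r).IsChain R → (∀ z ∈ (y :: r).getLast?, z < 8) →
      HasNinePath R := by
  induction n with
  | zero => simp [extendOne]
  | succ n ih =>
    intro E y U r h hE hperm hchain hlast
    rw [extendOne, Bool.or_eq_true, Bool.and_eq_true] at h
    rcases h with h | ⟨hy, h⟩
    · exact hasNinePath_of_containsMask hE h
    cases r with
    | nil =>
      obtain rfl := hperm.nil_eq
      have : y < 8 := hlast y (by simp)
      simp at hy
      omega
    | cons v r =>
      have hv : v ∈ U := hperm.subset (by simp)
      have := List.all_eq_true.1 h v hv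
      rw [applyEvaluated_eq] at this
      refine ih this (hE.lor (encodes_edgeMask hsymm hlt hchain.rel)) ?_ hchain.of_cons ?_
      · simpa using hperm.erase v
      · simpa using hlast

theorem hasNinePath_of_extendBoth (hsymm : ∀ x y, R x y → R y x) (hlt : ∀ x y, R x y → x < 10)
    (n : ℕ) : ∀ {E x y : ℕ} {U l r : List ℕ},
      extendBoth (detours.map pathMask) n E x y U = true →
      Encodes R E → (l ++ r).Perm U → (x :: l).IsChain R → (y :: r).IsChain R →
      (∀ z ∈ (x :: l).getLast?, z < 8) → (∀ z ∈ (y :: r).getLast?, z < 8) →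
      HasNinePath R := by
  induction n with
  | zero => simp [extendBoth]
  | succ n ih =>
    intro E x y U l r h hE hperm hl hr hl_last hr_last
    rw [extendBoth, Bool.or_eq_true, Bool.and_eq_true, Bool.or_eq_true] at h
    rcases h with h | ⟨h, h'⟩
    · exact hasNinePath_of_containsMask hE h
    cases l with
    | nil =>
      have hx : x < 8 := hl_last x (by simp)
      rcases h' with h' | h'
      · have := Nat.le_of_ble_eq_true h'
        omega
      · exact hasNinePath_of_extendOne hsymm hlt n h' hE (by simpa using hperm) hr hr_last
    | cons v l =>
      have hv : v ∈ U := hperm.subset (by simp)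
      have := List.all_eq_true.1 h v hv
      rw [applyEvaluated_eq] at this
      refine ih this (hE.lor (encodes_edgeMask hsymm hlt hl.rel)) ?_ hr hl.of_cons hr_last ?_
      · exact List.perm_append_comm.trans (by simpa using hperm.erase v)
      · simpa using hl_last

theorem hasNinePath_of_two_paths (hsymm : ∀ x y, R x y → R y x) (hlt : ∀ x y, R x y → x < 10)
    {i j : ℕ} (hi : 1 ≤ i ∧ i ≤ 6) (hj : 1 ≤ j ∧ j ≤ 6) (hij : i ≠ j) (hij₁ : i + 1 ≠ j)
    (hij₂ : i ≠ j + 1) (hpath : (List.range 8).IsChain R) (hi8 : R i 8) {l r : List ℕ}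
    (hperm : (l ++ r).Perm (otherLabels i j)) (hl : (8 :: l).IsChain R) (hr : (8 :: r).IsChain R)
    (hl_last : ∀ z ∈ (8 :: l).getLast?, z < 8) (hr_last : ∀ z ∈ (8 :: r).getLast?, z < 8) :
    HasNinePath R := by
  have h := List.all_eq_true.1 (List.all_eq_true.1 searchAll_detours i (by simp; omega)) j
    (by simp; omega)
  simp only [Bool.or_eq_true, Nat.beq_eq, Nat.succ_eq_add_one, hij, hij₁, hij₂, false_or] at h
  exact hasNinePath_of_extendBoth hsymm hlt 10 h
    ((encodes_pathMask hsymm hlt hpath).lor (encodes_edgeMask hsymm hlt hi8))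
    hperm hl hr hl_last hr_last

end Search

section Transfer

variable {V : Type*} {G : SimpleGraph V}

theorem exists_map_eq_of_isChain (g : V → ℕ) :
    ∀ {l : List ℕ} {u : V}, (g u :: l).IsChain (fun x y => ∃ u v, g u = x ∧ g v = y ∧ G.Adj u v) →
      Function.Injective g → ∃ l' : List V, l'.map g = l ∧ (u :: l').IsChain G.Adj
  | [], u, _, _ => ⟨[], rfl, .singleton u⟩
  | x :: l, u, h, hg => by
    obtain ⟨u', v, hu, rfl, hadj⟩ := h.rel
    obtain rfl := hg hu
    obtain ⟨l', rfl, hl'⟩ := exists_map_eq_of_isChain g h.of_cons hg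
    exact ⟨v :: l', rfl, List.isChain_cons_cons.2 ⟨hadj, hl'⟩⟩

/-- A path on nine labels pulls back to a path of length `8` in the graph. -/
theorem exists_isPath_of_hasNinePath {g : V → ℕ} (hg : Function.Injective g)
    (h : HasNinePath fun x y => ∃ u v, g u = x ∧ g v = y ∧ G.Adj u v) :
    ∃ (u v : V) (W : G.Walk u v), W.IsPath ∧ W.length = 8 := by
  obtain ⟨l, hnodup, hlen, hchain⟩ := h
  obtain _ | ⟨x, _ | ⟨y, l⟩⟩ := l
  · simp at hlen
  · simp at hlen
  obtain ⟨u, -, rfl, -, -⟩ := hchain.rel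
  obtain ⟨l', hl', hc⟩ := exists_map_eq_of_isChain g hchain hg
  refine ⟨_, _, Walk.ofSupport (u :: l') (by simp) hc, ?_, ?_⟩
  · rw [Walk.isPath_def, Walk.support_ofSupport]
    refine List.Nodup.of_map g ?_
    rwa [List.map_cons, hl']
  · rw [Walk.length_ofSupport, ← List.length_map (f := g), List.map_cons, hl', hlen]

theorem exists_isPath_of_adj {u₁ v₁ u₂ v₂ : V} {P : G.Walk u₁ v₁} {Q : G.Walk u₂ v₂}
    (hP : P.IsPath) (hQ : Q.IsPath) (hlen : P.length = 7)
    (hcover : ∀ x, x ∈ P.support ∨ x ∈ Q.support) {a b c d : V}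
    (hab : ∀ x, x ∈ P.support ∧ x ∉ Q.support ↔ x = a ∨ x = b)
    (hcd : ∀ x, x ∈ Q.support ∧ x ∉ P.support ↔ x = c ∨ x = d)
    (hne_ab : a ≠ b) (hne_cd : c ≠ d) (habP : s(a, b) ∉ P.edges)
    (ha₁ : u₁ ≠ a) (hb₁ : u₁ ≠ b) (ha₂ : v₁ ≠ a) (hb₂ : v₁ ≠ b)
    (hc₁ : u₂ ≠ c) (hd₁ : u₂ ≠ d) (hc₂ : v₂ ≠ c) (hd₂ : v₂ ≠ d) (hac : G.Adj a c) :
    ∃ (u v : V) (W : G.Walk u v), W.IsPath ∧ W.length = 8 := by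
  classical
  have hPa := ((hab a).2 (.inl rfl))
  have hPb := ((hab b).2 (.inr rfl))
  have hQc := ((hcd c).2 (.inl rfl))
  have hQd := ((hcd d).2 (.inr rfl))
  have hlenP : P.support.length = 8 := by simp [hlen]
  let g : V → ℕ := fun v => if v = c then 8 else if v = d then 9 else P.support.idxOf v
  have gc : g c = 8 := by simp [g]
  have gd : g d = 9 := by simp [g, hne_cd.symm]
  have gP : ∀ v ∈ P.support, g v = P.support.idxOf v := by
    intro v hv
    have h₁ : v ≠ c := by rintro rfl; exact hQc.2 hv
    have h₂ : v ≠ d := by rintro rfl; exact hQd.2 hv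
    simp [g, h₁, h₂]
  have gP_lt : ∀ v ∈ P.support, g v < 8 := by
    intro v hv
    rw [gP v hv, ← hlenP]
    exact List.idxOf_lt_length_of_mem hv
  have gP_inj : ∀ u ∈ P.support, ∀ v, g u = g v → u = v := by
    intro u hu v h
    by_cases hv : v ∈ P.support
    · rw [gP u hu, gP v hv] at h
      exact (List.idxOf_inj hu).1 h
    · have := gP_lt u hu
      rcases (hcd v).1 ⟨(hcover v).resolve_left hv, hv⟩ with rfl | rfl <;> omega
  have g_out : ∀ v, v ∉ P.support → v = c ∨ v = d := fun v hv =>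
    (hcd v).1 ⟨(hcover v).resolve_left hv, hv⟩
  have hg : Function.Injective g := by
    intro u v h
    by_cases hu : u ∈ P.support
    · exact gP_inj u hu v h
    by_cases hv : v ∈ P.support
    · exact (gP_inj v hv u h.symm).symm
    rcases g_out u hu with rfl | rfl <;> rcases g_out v hv with rfl | rfl <;>
      first | rfl | omega
  have g_lt : ∀ v, g v < 10 := by
    intro v
    by_cases hv : v ∈ P.support
    · have := gP_lt v hv; omega
    · rcases g_out v hv with rfl | rfl <;> omega
  have g_map : P.support.map g = List.range 8 := by
    refine List.ext_getElem (by simp [hlenP]) fun k hk _ => ?_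
    rw [List.getElem_map, gP _ (List.getElem_mem _), List.getElem_range]
    exact hP.support_nodup.idxOf_getElem _ _
  have g_vert : ∀ k, k ≤ 7 → g (P.getVert k) = k := by
    intro k hk
    rw [gP _ (P.getVert_mem_support k), Walk.getVert_eq_support_getElem _ (by omega)]
    exact hP.support_nodup.idxOf_getElem _ _
  have gu₁ : g u₁ = 0 := by simpa using g_vert 0 (by omega)
  have gv₁ : g v₁ = 7 := by simpa [← hlen] using g_vert 7 le_rfl
  have vert_g : ∀ v ∈ P.support, P.getVert (g v) = v := by
    intro v hv
    refine hg (g_vert _ ?_)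
    have := gP_lt v hv
    omega
  have edge_P : ∀ u ∈ P.support, ∀ v ∈ P.support, g u + 1 = g v → s(u, v) ∈ P.edges := by
    intro u hu v hv huv
    have := gP_lt v hv
    exact (P.mk_mem_edges_iff_exists).2
      ⟨g u, by omega, by rw [huv, vert_g u hu, vert_g v hv]⟩
  obtain ⟨l₁, l₂, hsplit⟩ := List.append_of_mem hQc.1
  have hQchain := Q.isChain_adj_support
  have hQnodup := hQ.support_nodup
  rw [hsplit] at hQchain hQnodup
  have memQ : ∀ x, x ∈ Q.support ↔ x = c ∨ x ∈ l₁ ∨ x ∈ l₂ := by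
    intro x; rw [hsplit]; simp; tauto
  have g_end : ∀ v ∈ Q.support, v ≠ c → v ≠ d → g v < 8 := by
    intro v hv h₁ h₂
    refine gP_lt v ?_
    by_contra hvP
    exact (g_out v hvP).elim h₁ h₂
  have gu₂ : g u₂ < 8 := g_end _ Q.start_mem_support hc₁ hd₁
  have gv₂ : g v₂ < 8 := g_end _ Q.end_mem_support hc₂ hd₂
  have hRmap : ∀ {l : List V}, l.IsChain G.Adj →
      (l.map g).IsChain fun x y => ∃ u v, g u = x ∧ g v = y ∧ G.Adj u v := fun h =>
    List.isChain_map_of_isChain g (fun u v huv => ⟨u, v, rfl, rfl, huv⟩) h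
  refine exists_isPath_of_hasNinePath hg (hasNinePath_of_two_paths ?_ ?_ (i := g a) (j := g b)
    (l := l₁.reverse.map g) (r := l₂.map g) ?_ ?_ ?_ ?_ ?_ ?_ ?_ ?_ ?_ ?_ ?_ ?_)
  · rintro _ _ ⟨u, v, rfl, rfl, huv⟩
    exact ⟨v, u, rfl, rfl, huv.symm⟩
  · rintro _ _ ⟨u, v, rfl, rfl, huv⟩
    exact g_lt u
  · have h₁ : g a ≠ 0 := fun h => ha₁ (hg (gu₁.trans h.symm))
    have h₂ : g a ≠ 7 := fun h => ha₂ (hg (gv₁.trans h.symm))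
    have := gP_lt a hPa.1
    omega
  · have h₁ : g b ≠ 0 := fun h => hb₁ (hg (gu₁.trans h.symm))
    have h₂ : g b ≠ 7 := fun h => hb₂ (hg (gv₁.trans h.symm))
    have := gP_lt b hPb.1
    omega
  · exact fun h => hne_ab (hg h)
  · exact fun h => habP (edge_P a hPa.1 b hPb.1 h)
  · exact fun h => habP (Sym2.eq_swap ▸ edge_P b hPb.1 a hPa.1 h.symm)
  · rw [← g_map]
    exact hRmap P.isChain_adj_support
  · exact ⟨a, c, rfl, gc, hac⟩
  · have hnodup : (l₁.reverse ++ l₂).Nodup :=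
      (((List.reverse_perm l₁).append_right l₂).nodup_iff).2
        (hQnodup.sublist (List.Sublist.append_left (List.sublist_cons_self c l₂) l₁))
    have hc_mem : c ∉ l₁ ∧ c ∉ l₂ := by
      have := (List.nodup_middle.1 hQnodup)
      simpa using (List.nodup_cons.1 this).1
    have hrange : (List.range 8).Nodup := List.nodup_range
    rw [← List.map_append]
    refine (List.perm_ext_iff_of_nodup (hnodup.map hg) ?_).2 fun x => ?_
    · refine List.nodup_cons.2 ⟨fun h => ?_, (hrange.erase _).erase _⟩
      simpa using List.mem_of_mem_erase (List.mem_of_mem_erase h)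
    · rw [otherLabels, List.mem_cons, (hrange.erase _).mem_erase_iff, hrange.mem_erase_iff,
        List.mem_range, List.mem_map]
      constructor
      · rintro ⟨v, hv, rfl⟩
        have hv' : v ∈ l₁ ∨ v ∈ l₂ := by simpa using hv
        have hvQ : v ∈ Q.support := (memQ v).2 (.inr hv')
        have hvc : v ≠ c := by rintro rfl; exact hv'.elim hc_mem.1 hc_mem.2
        by_cases hvd : v = d
        · exact .inl (hvd ▸ gd)
        · refine .inr ⟨fun h => hPb.2 (hg h ▸ hvQ), fun h => hPa.2 (hg h ▸ hvQ), ?_⟩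
          exact g_end v hvQ hvc hvd
      · rintro (rfl | ⟨hxb, hxa, hx⟩)
        · refine ⟨d, ?_, gd⟩
          simpa [hne_cd.symm] using (memQ d).1 hQd.1
        · have hgx := g_vert x (by omega)
          refine ⟨P.getVert x, ?_, hgx⟩
          have hxc : P.getVert x ≠ c := fun h => by rw [h, gc] at hgx; omega
          have hxQ : P.getVert x ∈ Q.support := by
            by_contra h
            rcases (hab _).1 ⟨P.getVert_mem_support x, h⟩ with h | h
            · exact hxa (by rw [← h, hgx])
            · exact hxb (by rw [← h, hgx])
          simpa [hxc] using (memQ _).1 hxQ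
  · rw [← gc, ← List.map_cons]
    refine hRmap ?_
    have : (l₁ ++ [c]).IsChain G.Adj := by
      refine List.IsChain.left_of_append (l₂ := l₂) ?_
      simpa using hQchain
    simpa using List.isChain_reverse.2 (this.imp fun _ _ h => h.symm)
  · rw [← gc, ← List.map_cons]
    exact hRmap hQchain.right_of_append
  · have hlast : (c :: l₁.reverse).getLast? = some u₂ := by
      have h : Q.support.head? = some u₂ := by rw [← Q.cons_tail_support]; rfl
      rw [hsplit] at h
      rw [show c :: l₁.reverse = (l₁ ++ [c]).reverse by simp, List.getLast?_reverse]
      cases l₁ <;> simpa using h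
    rw [show 8 :: l₁.reverse.map g = (c :: l₁.reverse).map g by simp [gc], List.getLast?_map, hlast]
    simpa using gu₂
  · have hlast : (c :: l₂).getLast? = some v₂ := by
      have h : Q.support.getLast? = some v₂ := by
        rw [List.getLast?_eq_some_getLast Q.support_ne_nil, Q.getLast_support]
      rw [hsplit] at h
      simpa using h
    rw [show 8 :: l₂.map g = (c :: l₂).map g by simp [gc], List.getLast?_map, hlast]
    simpa using gv₂

/-- A connected induced subgraph has an edge between the two parts of its vertex set. -/
theorem exists_adj_of_induce_connected {a b c d : V}
    (hind : (G.induce ({a, b, c, d} : Set V)).Connected) (hca : c ≠ a) (hcb : c ≠ b) :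
    G.Adj a c ∨ G.Adj a d ∨ G.Adj b c ∨ G.Adj b d := by
  obtain ⟨W⟩ := hind.preconnected ⟨a, by simp⟩ ⟨c, by simp⟩
  obtain ⟨e, -, he₁, he₂⟩ := W.exists_boundary_dart {x | x.1 = a ∨ x.1 = b} (by simp)
    (by simp [hca, hcb])
  have hadj : G.Adj e.fst.1 e.snd.1 := e.adj
  have hmem := e.snd.2
  simp only [Set.mem_ofPred_eq, Set.mem_insert_iff, Set.mem_singleton_iff] at he₁ he₂ hmem
  rcases he₁ with h | h <;> rcases hmem with h' | h' | h' | h' <;> rw [h, h'] at hadj <;> simp_all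

theorem ncard_setOf_mem_support {u v : V} {P : G.Walk u v} (hP : P.IsPath) :
    {x | x ∈ P.support}.ncard = P.length + 1 := by
  classical
  rw [← P.length_support, ← List.toFinset_card_of_nodup hP.support_nodup, ← Set.ncard_coe_finset]
  simp

end Transfer

/-- Case 3: there is no simple graph on exactly 10 vertices with longest
paths `P`, `Q` such that `V(G) = V(P) ∪ V(Q)`, `|V(P) ∩ V(Q)| = 6`,
`V(P) \ V(Q) = {a, b}` with `a`, `b` not consecutive on `P`, `V(Q) \ V(P) = {c, d}`
with `c`, `d` not consecutive on `Q`, the subgraph induced on `{a, b, c, d}` connected,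
and no endpoint of `P` in `{a, b}` and no endpoint of `Q` in `{c, d}`. -/
theorem statement19 {V : Type*} [Fintype V] (G : SimpleGraph V)
    (hcard : Fintype.card V = 10)
    {u₁ v₁ u₂ v₂ : V} (P : G.Walk u₁ v₁) (Q : G.Walk u₂ v₂)
    (hP : IsLongestPath G P) (hQ : IsLongestPath G Q)
    (hcover : {x | x ∈ P.support} ∪ {x | x ∈ Q.support} = Set.univ)
    (hint : ({x | x ∈ P.support} ∩ {x | x ∈ Q.support}).ncard = 6)
    (a b c d : V)
    (hab : {x | x ∈ P.support} \ {x | x ∈ Q.support} = {a, b})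
    (habP : s(a, b) ∉ P.edges)
    (hcd : {x | x ∈ Q.support} \ {x | x ∈ P.support} = {c, d})
    (hcdQ : s(c, d) ∉ Q.edges)
    (hind : (G.induce ({a, b, c, d} : Set V)).Connected)
    (hPa : u₁ ∉ ({a, b} : Set V)) (hPb : v₁ ∉ ({a, b} : Set V))
    (hQc : u₂ ∉ ({c, d} : Set V)) (hQd : v₂ ∉ ({c, d} : Set V)) :
    False := by
  have hlen : P.length = Q.length := le_antisymm (hQ.2 P hP.1) (hP.2 Q hQ.1)
  have hPcard := ncard_setOf_mem_support hP.1
  have hQcard := ncard_setOf_mem_support hQ.1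
  have hfinP : {x | x ∈ P.support}.Finite := Set.toFinite _
  have hfinQ : {x | x ∈ Q.support}.Finite := Set.toFinite _
  have h₁ := Set.ncard_inter_add_ncard_sdiff_eq_ncard {x | x ∈ P.support} {x | x ∈ Q.support} hfinP
  have h₂ := Set.ncard_inter_add_ncard_sdiff_eq_ncard {x | x ∈ Q.support} {x | x ∈ P.support} hfinQ
  have h₃ := Set.ncard_union_add_ncard_inter {x | x ∈ P.support} {x | x ∈ Q.support} hfinP hfinQ
  rw [hcover, Set.ncard_univ, Nat.card_eq_fintype_card, hcard] at h₃
  rw [Set.inter_comm] at h₂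
  have hne_ab : a ≠ b := by
    rintro rfl
    rw [hab, Set.pair_eq_singleton, Set.ncard_singleton] at h₁
    omega
  have hne_cd : c ≠ d := by
    rintro rfl
    rw [hcd, Set.pair_eq_singleton, Set.ncard_singleton] at h₂
    omega
  have hlenP : P.length = 7 := by omega
  have hcover' : ∀ x, x ∈ P.support ∨ x ∈ Q.support := fun x =>
    (hcover.symm ▸ Set.mem_univ x : x ∈ {x | x ∈ P.support} ∪ {x | x ∈ Q.support})
  have hab' : ∀ x, x ∈ P.support ∧ x ∉ Q.support ↔ x = a ∨ x = b := fun x => Set.ext_iff.1 hab x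
  have hcd' : ∀ x, x ∈ Q.support ∧ x ∉ P.support ↔ x = c ∨ x = d := fun x => Set.ext_iff.1 hcd x
  simp only [Set.mem_insert_iff, Set.mem_singleton_iff, not_or] at hPa hPb hQc hQd
  have hcP := ((hcd' c).2 (.inl rfl)).2
  have hca : c ≠ a := fun h => hcP (h ▸ ((hab' a).2 (.inl rfl)).1)
  have hcb : c ≠ b := fun h => hcP (h ▸ ((hab' b).2 (.inr rfl)).1)
  have hba' : ∀ x, x ∈ P.support ∧ x ∉ Q.support ↔ x = b ∨ x = a := fun x =>
    (hab' x).trans or_comm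
  have hdc' : ∀ x, x ∈ Q.support ∧ x ∉ P.support ↔ x = d ∨ x = c := fun x =>
    (hcd' x).trans or_comm
  have hbaP : s(b, a) ∉ P.edges := Sym2.eq_swap ▸ habP
  suffices h : ∃ (u v : V) (W : G.Walk u v), W.IsPath ∧ W.length = 8 by
    obtain ⟨u, v, W, hW, hWlen⟩ := h
    have := hP.2 W hW
    omega
  rcases exists_adj_of_induce_connected hind hca hcb with h | h | h | h
  · exact exists_isPath_of_adj hP.1 hQ.1 hlenP hcover' hab' hcd' hne_ab hne_cd habP
      hPa.1 hPa.2 hPb.1 hPb.2 hQc.1 hQc.2 hQd.1 hQd.2 h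
  · exact exists_isPath_of_adj hP.1 hQ.1 hlenP hcover' hab' hdc' hne_ab hne_cd.symm habP
      hPa.1 hPa.2 hPb.1 hPb.2 hQc.2 hQc.1 hQd.2 hQd.1 h
  · exact exists_isPath_of_adj hP.1 hQ.1 hlenP hcover' hba' hcd' hne_ab.symm hne_cd hbaP
      hPa.2 hPa.1 hPb.2 hPb.1 hQc.1 hQc.2 hQd.1 hQd.2 h
  · exact exists_isPath_of_adj hP.1 hQ.1 hlenP hcover' hba' hdc' hne_ab.symm hne_cd.symm hbaP
      hPa.2 hPa.1 hPb.2 hPb.1 hQc.2 hQc.1 hQd.2 hQd.1 h
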